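/- Let (r, u, v, t) be a composition of n, and let D be the (r,u,v,t)-tableau whose row-1 entries all equal 1, whose row-2 and row-3 entries all equal 2, and whose row-4 entries all equal 3. Let E be a row-standard (r, u+v, t)-tableau of any type λ ⊨ n, and let 𝒞 be the set of all row-standard (r,u,v,t)-tableaux C such that C^1 = E^1, C^2 ⊔ C^3 = E^2 and C^4 = E^3. Then the composite φ_D φ_E : M^{(r,u,v,t)} → M^λ (apply φ_D first) equals ∑_{C ∈ 𝒞} φ_C. -/

import Mathlib

open scoped Classical

noncomputable section

namespace FayersSemistd

/-- The value at `q` of the Gaussian (quantum) binomial coefficient polynomial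
`[a choose b]`, defined via the `q`-Pascal recurrence. -/
def qBinom {F : Type*} [Field F] (q : F) : ℕ → ℕ → F
  | _, 0 => 1
  | 0, _+1 => 0
  | a+1, b+1 => qBinom q a b + q ^ (b+1) * qBinom q a (b+1)

/-- `∏_i [A_i + B_i choose A_i]_q`, where `A_i`, `B_i` are multiplicities in the
multisets `A` and `B`. -/
def qBinomProd {F : Type*} [Field F] (q : F) (A B : Multiset ℕ) : F :=
  ∏ i ∈ (A + B).toFinset, qBinom q ((A + B).count i) (A.count i)

/-- `∑_{i<j} A_j * B_i` : the number of pairs `(x,y)` with `x ∈ A`, `y ∈ B`, `y < x`,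
counted with multiplicity. -/
def invPairs (A B : Multiset ℕ) : ℕ :=
  ((A.product B).filter (fun p => p.2 < p.1)).card

/-- The Coxeter length of a permutation of `{0,…,n-1}`: its number of inversions. -/
def permLength {n : ℕ} (w : Equiv.Perm (Fin n)) : ℕ :=
  (Finset.univ.filter (fun p : Fin n × Fin n => p.1 < p.2 ∧ w p.2 < w p.1)).card

/-- `λ_0 + ⋯ + λ_{r-1}`. -/
def cumSum (lam : ℕ → ℕ) (r : ℕ) : ℕ := ∑ i ∈ Finset.range r, lam i

/-- The (0-indexed) row of the diagram of `λ` containing the (0-indexed) position `p`,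
when positions are listed row by row. -/
def rowOf (lam : ℕ → ℕ) (p : ℕ) : ℕ := sInf {r | p < cumSum lam (r+1)}

/-- `λ` is a composition of `n`: finitely many nonzero parts, summing to `n`. -/
def IsComposition (n : ℕ) (lam : ℕ → ℕ) : Prop :=
  ∃ N, (∀ r, N ≤ r → lam r = 0) ∧ cumSum lam N = n

/-- `μ` is a partition of `n`. -/
def IsPartition (n : ℕ) (mu : ℕ → ℕ) : Prop := IsComposition n mu ∧ Antitone mu

/-- The conjugate partition (0-indexed): `conjP μ i = #{r | μ r > i}`. -/
def conjP (mu : ℕ → ℕ) (i : ℕ) : ℕ := sInf {r | mu r ≤ i}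

/-- The standard Young subgroup `W_λ` of `S_n` (as a set): the permutations preserving
each consecutive block of sizes `λ_0, λ_1, …`. -/
def youngW {n : ℕ} (lam : ℕ → ℕ) : Set (Equiv.Perm (Fin n)) :=
  {w | ∀ p : Fin n, rowOf lam ((w p : Fin n) : ℕ) = rowOf lam (p : ℕ)}

/-- The adjacent transposition `(i, i+1)` (0-indexed) in `S_n`. -/
def adjT {n : ℕ} (i : ℕ) (h : i + 1 < n) : Equiv.Perm (Fin n) :=
  Equiv.swap ⟨i, Nat.lt_of_succ_lt h⟩ ⟨i+1, h⟩

/-- `T : S_n → H` is the standard basis of an Iwahori–Hecke algebra of `S_n` over `F`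
with parameter `q`.  Permutations act on the right, so the product `w·s` of the paper
is `s * w` in Mathlib's convention; the multiplication rule
`T_w T_s = T_{ws}` (length increasing) resp. `T_w T_s = q T_{ws} + (q-1) T_w`
(length decreasing) determines the algebra structure on the basis. -/
structure IsHeckeBasis {F : Type*} [Field F] {H : Type*} [Ring H] [Algebra F H] {n : ℕ}
    (q : F) (T : Equiv.Perm (Fin n) → H) : Prop where
  li : LinearIndependent F T
  total : Submodule.span F (Set.range T) = ⊤
  one : T 1 = 1
  mul_adj_asc : ∀ (w : Equiv.Perm (Fin n)) (i : ℕ) (h : i + 1 < n),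
    permLength w < permLength (adjT i h * w) →
    T w * T (adjT i h) = T (adjT i h * w)
  mul_adj_desc : ∀ (w : Equiv.Perm (Fin n)) (i : ℕ) (h : i + 1 < n),
    permLength (adjT i h * w) < permLength w →
    T w * T (adjT i h) = q • T (adjT i h * w) + (q - 1) • T w

variable {F : Type*} [Field F] {H : Type*} [Ring H] [Algebra F H] {n : ℕ}

/-- `x_λ = ∑_{w ∈ W_λ} T_w`. -/
def xElt (T : Equiv.Perm (Fin n) → H) (lam : ℕ → ℕ) : H :=
  ∑ w ∈ Finset.univ.filter (· ∈ youngW lam), T w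

/-- `y_λ = ∑_{w ∈ W_λ} (-q)^{-l(w)} T_w`. -/
def yElt (q : F) (T : Equiv.Perm (Fin n) → H) (lam : ℕ → ℕ) : H :=
  ∑ w ∈ Finset.univ.filter (· ∈ youngW lam), ((-q)⁻¹) ^ permLength w • T w

/-- The double coset `W_λ d W_μ` (paper convention: maps act on the right, so the
paper product `u·d·v` is `v * d * u` in Mathlib's convention). -/
def doubleCoset {n : ℕ} (lam mu : ℕ → ℕ) (d : Equiv.Perm (Fin n)) :
    Set (Equiv.Perm (Fin n)) :=
  {w | ∃ u ∈ youngW (n := n) lam, ∃ v ∈ youngW (n := n) mu, w = v * d * u}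

/-- `∑_{w ∈ W_λ 1_A W_μ} T_w`, the image `x_μ φ_A` of `x_μ` under the tableau
homomorphism `φ_A : M^μ → M^λ`, where `d = 1_A`. -/
def XPhi (T : Equiv.Perm (Fin n) → H) (lam mu : ℕ → ℕ) (d : Equiv.Perm (Fin n)) : H :=
  ∑ w ∈ Finset.univ.filter (· ∈ doubleCoset lam mu d), T w

/-- A row-standard tableau is recorded by the multisets of entries of its rows; it has
shape `μ` when row `r` has `μ_r` entries. -/
def RowsOfShape (mu : ℕ → ℕ) (A : ℕ → Multiset ℕ) : Prop := ∀ r, (A r).card = mu r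

/-- The tableau with rows `A 0, A 1, …` has type `λ` when the entry `v` occurs `λ_v`
times in total (entries and types are 0-indexed). -/
def HasType (A : ℕ → Multiset ℕ) (lam : ℕ → ℕ) : Prop :=
  ∀ v, (∑ᶠ r, (A r).count v) = lam v

/-- The entry in row `r`, column `c` (0-indexed) of the row-standard tableau with row
multisets `A`. -/
def entryAt (A : ℕ → Multiset ℕ) (r c : ℕ) : ℕ := ((A r).sort (· ≤ ·)).getD c 0

/-- `d = 1_A` for the row-standard `μ`-tableau `A` of type `λ`: the tableau `t^λ d`
(whose entry at position `p` is `d p`) is row-standard (first clause), and the entry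
`d p` lies in row `r` of `t^λ d` exactly when the position occupied by `d p` in `t^μ`
is occupied by `r` in `A` (second clause). -/
def Is1A {n : ℕ} (mu lam : ℕ → ℕ) (A : ℕ → Multiset ℕ) (d : Equiv.Perm (Fin n)) : Prop :=
  (∀ p p' : Fin n, rowOf lam (p : ℕ) = rowOf lam (p' : ℕ) → p < p' → d p < d p') ∧
  (∀ p : Fin n,
    entryAt A (rowOf mu ((d p : Fin n) : ℕ))
      (((d p : Fin n) : ℕ) - cumSum mu (rowOf mu ((d p : Fin n) : ℕ)))
      = rowOf lam (p : ℕ))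

/-- A row-standard tableau is semistandard if its columns are strictly increasing. -/
def Semistandard (mu : ℕ → ℕ) (A : ℕ → Multiset ℕ) : Prop :=
  ∀ r c, c < mu (r+1) → entryAt A r c < entryAt A (r+1) c

/-- The (0-indexed) column of the position `p` in the diagram of `μ`. -/
def colIdx (mu : ℕ → ℕ) (p : ℕ) : ℕ := p - cumSum mu (rowOf mu p)

/-- `w = w_μ`, i.e. `t^μ w = t_μ`: the image of position `p` is the number of positions
coming strictly before `p` in the column-reading order of the diagram of `μ`. -/
def IsWmu {n : ℕ} (mu : ℕ → ℕ) (w : Equiv.Perm (Fin n)) : Prop :=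
  ∀ p : Fin n, ((w p : Fin n) : ℕ) = (Finset.univ.filter (fun p' : Fin n =>
    colIdx mu (p' : ℕ) < colIdx mu (p : ℕ) ∨
      (colIdx mu (p' : ℕ) = colIdx mu (p : ℕ) ∧ rowOf mu (p' : ℕ) < rowOf mu (p : ℕ)))).card

def comp1 (a : ℕ) : ℕ → ℕ := fun r => if r = 0 then a else 0
def comp2 (a b : ℕ) : ℕ → ℕ := fun r => if r = 0 then a else if r = 1 then b else 0
def comp3 (a b c : ℕ) : ℕ → ℕ :=
  fun r => if r = 0 then a else if r = 1 then b else if r = 2 then c else 0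
def comp4 (a b c d : ℕ) : ℕ → ℕ :=
  fun r => if r = 0 then a else if r = 1 then b else if r = 2 then c else if r = 3 then d else 0
def rows1 (a : Multiset ℕ) : ℕ → Multiset ℕ := fun r => if r = 0 then a else 0
def rows2 (a b : Multiset ℕ) : ℕ → Multiset ℕ :=
  fun r => if r = 0 then a else if r = 1 then b else 0
def rows3 (a b c : Multiset ℕ) : ℕ → Multiset ℕ :=
  fun r => if r = 0 then a else if r = 1 then b else if r = 2 then c else 0
def rows4 (a b c d : Multiset ℕ) : ℕ → Multiset ℕ :=
  fun r => if r = 0 then a else if r = 1 then b else if r = 2 then c else if r = 3 then d else 0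

end FayersSemistd
namespace FayersSemistd

theorem rowOf_eq_iff {n : ℕ} {mu : ℕ → ℕ} (hmu : IsComposition n mu) {p : ℕ} (hp : p < n)
    (b : ℕ) : rowOf mu p = b ↔ cumSum mu b ≤ p ∧ p < cumSum mu (b + 1) := by
  have hmono : Monotone (cumSum mu) := fun i j hij =>
    Finset.sum_le_sum_of_subset (Finset.range_mono hij)
  obtain ⟨N, -, hN⟩ := hmu
  have hne : {r | p < cumSum mu (r + 1)}.Nonempty :=
    ⟨N, lt_of_lt_of_le (hN ▸ hp) (hmono N.le_succ)⟩
  constructor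
  · rintro rfl
    refine ⟨?_, Nat.sInf_mem hne⟩
    by_contra! hlt
    rcases h : rowOf mu p with _ | m
    · simp [h, cumSum] at hlt
    · rw [h] at hlt
      have : rowOf mu p ≤ m := Nat.sInf_le hlt
      omega
  · rintro ⟨h1, h2⟩
    refine le_antisymm (Nat.sInf_le h2) ?_
    by_contra! hlt
    have h3 : p < cumSum mu (rowOf mu p + 1) := Nat.sInf_mem hne
    have h4 := hmono (Nat.succ_le_of_lt hlt)
    simp only [Nat.succ_eq_add_one] at h4
    omega

theorem cumSum_le {n : ℕ} {mu : ℕ → ℕ} (hmu : IsComposition n mu) (b : ℕ) :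
    cumSum mu b ≤ n := by
  obtain ⟨N, h0, hN⟩ := hmu
  rw [← hN]
  rcases le_total b N with h | h
  · exact Finset.sum_le_sum_of_subset (Finset.range_mono h)
  · refine (Finset.sum_subset (Finset.range_mono h) fun i _ hi => h0 i ?_).ge
    simpa using hi

/-- The multiset of entries in row `b` of the `μ`-tableau of type `λ` whose entry at the
position `w p` is the row of `p` in the diagram of `λ`. -/
def rowContent {n : ℕ} (mu lam : ℕ → ℕ) (w : Equiv.Perm (Fin n)) (b : ℕ) : Multiset ℕ :=
  (Finset.univ.filter (fun k : Fin n => rowOf mu k = b)).val.map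
    (fun k => rowOf lam (w⁻¹ k : Fin n))

theorem count_map_pair {n : ℕ} (mu lam : ℕ → ℕ) (w : Equiv.Perm (Fin n)) (a b : ℕ) :
    (Finset.univ.val.map (fun p : Fin n => (rowOf lam p, rowOf mu (w p : Fin n)))).count (a, b)
      = (rowContent mu lam w b).count a := by
  rw [rowContent, Multiset.count_map, Multiset.count_map, ← Finset.filter_val,
    ← Finset.filter_val, Finset.card_val, Finset.card_val]
  refine Finset.card_bij (fun p _ => w p) ?_ (fun _ _ _ _ h => w.injective h) ?_
  · intro p hp
    simp_all
  · intro k hk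
    refine ⟨w⁻¹ k, ?_, by simp⟩
    simp_all

theorem rowContent_eq_iff_map_pair_eq {n : ℕ} (mu lam : ℕ → ℕ) (w d : Equiv.Perm (Fin n)) :
    rowContent mu lam w = rowContent mu lam d ↔
      Finset.univ.val.map (fun p : Fin n => (rowOf lam p, rowOf mu (w p : Fin n)))
        = Finset.univ.val.map (fun p : Fin n => (rowOf lam p, rowOf mu (d p : Fin n))) := by
  constructor
  · intro h
    ext ⟨a, b⟩
    rw [count_map_pair, count_map_pair, h]
  · intro h
    funext b
    ext a
    rw [← count_map_pair, ← count_map_pair, h]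

theorem map_univ_eq_map_univ_iff {α β : Type*} [Fintype α] (f g : α → β) :
    Finset.univ.val.map f = Finset.univ.val.map g ↔ ∃ σ : Equiv.Perm α, f = g ∘ σ := by
  constructor
  · intro h
    have hcard : ∀ c, Nonempty ({a // f a = c} ≃ {a // g a = c}) := by
      intro c
      have hc := congrArg (Multiset.count c) h
      rw [Multiset.count_map, Multiset.count_map, ← Finset.filter_val, ← Finset.filter_val,
        Finset.card_val, Finset.card_val] at hc
      refine Fintype.card_eq.1 ?_
      simpa only [Fintype.card_subtype, eq_comm (a := c)] using hc
    let e := fun c => (hcard c).some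
    exact ⟨Equiv.ofFiberEquiv e, funext fun a => (Equiv.ofFiberEquiv_map e a).symm⟩
  · rintro ⟨σ, rfl⟩
    rw [← Multiset.map_map, Multiset.map_univ_val_equiv]

theorem mem_doubleCoset_iff {n : ℕ} (lam mu : ℕ → ℕ) (w d : Equiv.Perm (Fin n)) :
    w ∈ doubleCoset lam mu d ↔ rowContent mu lam w = rowContent mu lam d := by
  rw [rowContent_eq_iff_map_pair_eq, map_univ_eq_map_univ_iff]
  constructor
  · rintro ⟨u, hu, v, hv, rfl⟩
    refine ⟨u, funext fun p => ?_⟩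
    simp [hu p, hv (d (u p))]
  · rintro ⟨σ, hσ⟩
    have hσ' := fun p => Prod.ext_iff.mp (congrFun hσ p)
    refine ⟨σ, fun p => (hσ' p).1.symm, w * σ⁻¹ * d⁻¹, fun k => ?_, by group⟩
    simpa using (hσ' (σ⁻¹ (d⁻¹ k))).2

theorem rowContent_of_is1A {n : ℕ} {mu lam : ℕ → ℕ} {A : ℕ → Multiset ℕ}
    {d : Equiv.Perm (Fin n)} (hmu : IsComposition n mu) (hA : RowsOfShape mu A)
    (hd : Is1A mu lam A d) : rowContent mu lam d = A := by
  funext b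
  have hlen : ((A b).sort (· ≤ ·)).length = mu b := by simp [hA b]
  have hsucc : cumSum mu (b + 1) = cumSum mu b + mu b := Finset.sum_range_succ _ _
  have hle := cumSum_le hmu (b + 1)
  have hrange : (Finset.range (mu b)).val.map (entryAt A b) = A b := by
    conv_rhs => rw [← Multiset.sort_eq (A b) (· ≤ ·)]
    rw [Finset.range_val, Multiset.range, Multiset.map_coe]
    congr 1
    refine List.ext_getElem (by simp [hlen]) fun i h1 h2 => ?_
    simp [entryAt, List.getElem?_eq_getElem h2]
  rw [← hrange]
  refine Multiset.map_eq_map_of_bij_of_nodup _ _ (Finset.nodup _) (Finset.nodup _)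
    (fun k _ => (k : ℕ) - cumSum mu b) ?_ ?_ ?_ ?_
  · intro k hk
    have hk' := (rowOf_eq_iff hmu k.2 b).1 (by simpa using hk)
    simp only [Finset.mem_val, Finset.mem_range]
    omega
  · intro k hk l hl h
    have hk' := (rowOf_eq_iff hmu k.2 b).1 (by simpa using hk)
    have hl' := (rowOf_eq_iff hmu l.2 b).1 (by simpa using hl)
    ext
    omega
  · intro c hc
    simp only [Finset.mem_val, Finset.mem_range] at hc
    refine ⟨⟨cumSum mu b + c, by omega⟩, ?_, by simp⟩
    simp only [Finset.mem_val, Finset.mem_filter, Finset.mem_univ, true_and]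
    rw [rowOf_eq_iff hmu (by omega)]
    omega
  · intro k hk
    have hk' : rowOf mu k = b := by simpa using hk
    have := hd.2 (d⁻¹ k)
    rw [← this]
    simp [hk']

theorem isComposition_comp3 (a b c : ℕ) : IsComposition (a + b + c) (comp3 a b c) := by
  refine ⟨3, fun r hr => ?_, by simp [cumSum, comp3, Finset.sum_range_succ]⟩
  simp only [comp3]
  split_ifs <;> omega

theorem isComposition_comp4 (a b c d : ℕ) :
    IsComposition (a + b + c + d) (comp4 a b c d) := by
  refine ⟨4, fun r hr => ?_, by simp [cumSum, comp4, Finset.sum_range_succ]⟩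
  simp only [comp4]
  split_ifs <;> omega

theorem rowsOfShape_rows3 (A B C : Multiset ℕ) :
    RowsOfShape (comp3 A.card B.card C.card) (rows3 A B C) := by
  intro r
  simp only [comp3, rows3]
  split_ifs <;> simp

theorem rowsOfShape_rows4 (A B C D : Multiset ℕ) :
    RowsOfShape (comp4 A.card B.card C.card D.card) (rows4 A B C D) := by
  intro r
  simp only [comp4, rows4]
  split_ifs <;> simp

theorem rowOf_comp4_cases {a b c d p : ℕ} (hp : p < a + b + c + d) :
    (rowOf (comp4 a b c d) p = 0 ∧ rowOf (comp3 a (b + c) d) p = 0) ∨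
    (rowOf (comp4 a b c d) p = 1 ∧ rowOf (comp3 a (b + c) d) p = 1) ∨
    (rowOf (comp4 a b c d) p = 2 ∧ rowOf (comp3 a (b + c) d) p = 1) ∨
    (rowOf (comp4 a b c d) p = 3 ∧ rowOf (comp3 a (b + c) d) p = 2) := by
  have h3 : IsComposition (a + b + c + d) (comp3 a (b + c) d) := by
    simpa [add_assoc] using isComposition_comp3 a (b + c) d
  simp only [rowOf_eq_iff (isComposition_comp4 a b c d) hp, rowOf_eq_iff h3 hp]
  simp only [cumSum, comp3, comp4, Finset.sum_range_succ, Finset.sum_range_zero]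
  norm_num
  omega

theorem youngW_comp4_subset (a b c d : ℕ) :
    youngW (n := a + b + c + d) (comp4 a b c d) ⊆ youngW (comp3 a (b + c) d) := by
  intro w hw p
  have h := hw p
  have h1 := rowOf_comp4_cases p.2
  have h2 := rowOf_comp4_cases (w p).2
  omega

theorem rowContent_comp3 (a b c d : ℕ) (lam : ℕ → ℕ) (w : Equiv.Perm (Fin (a + b + c + d))) :
    rowContent (comp3 a (b + c) d) lam w =
      rows3 (rowContent (comp4 a b c d) lam w 0)
        (rowContent (comp4 a b c d) lam w 1 + rowContent (comp4 a b c d) lam w 2)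
        (rowContent (comp4 a b c d) lam w 3) := by
  have key : ∀ k : Fin (a + b + c + d), _ := fun k => rowOf_comp4_cases k.2
  funext i
  simp only [rows3]
  split_ifs with h0 h1 h2
  · subst h0
    unfold rowContent
    congr 2
    ext k
    have := key k
    simp
    omega
  · subst h1
    unfold rowContent
    rw [← Multiset.map_add]
    congr 1
    refine congrArg Finset.val (a₂ := Finset.disjUnion _ _
      (Finset.disjoint_filter.2 (by intros; omega))) ?_
    ext k
    have := key k
    simp
    omega
  · subst h2
    unfold rowContent
    congr 2
    ext k
    have := key k
    simp
    omega
  · unfold rowContent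
    rw [Finset.filter_false_of_mem]
    · rfl
    · intro k _
      have := key k
      omega

theorem rowContent_comp4_of_four_le (a b c d : ℕ) (lam : ℕ → ℕ)
    (w : Equiv.Perm (Fin (a + b + c + d))) {i : ℕ} (hi : 4 ≤ i) :
    rowContent (comp4 a b c d) lam w i = 0 := by
  unfold rowContent
  rw [Finset.filter_false_of_mem]
  · rfl
  · intro k _
    have := rowOf_comp4_cases k.2
    omega

theorem rowContent_comp4_eq_rows4 (a b c d : ℕ) (lam : ℕ → ℕ)
    (w : Equiv.Perm (Fin (a + b + c + d))) (A B C D : Multiset ℕ) :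
    rowContent (comp4 a b c d) lam w = rows4 A B C D ↔
      rowContent (comp4 a b c d) lam w 0 = A ∧ rowContent (comp4 a b c d) lam w 1 = B ∧
      rowContent (comp4 a b c d) lam w 2 = C ∧ rowContent (comp4 a b c d) lam w 3 = D := by
  constructor
  · intro h
    simp [h, rows4]
  · rintro ⟨rfl, rfl, rfl, rfl⟩
    funext i
    simp only [rows4]
    split_ifs <;> try (subst_vars; rfl)
    exact rowContent_comp4_of_four_le _ _ _ _ _ _ (by omega)

theorem rows3_inj {A B C A' B' C' : Multiset ℕ} :
    rows3 A B C = rows3 A' B' C' ↔ A = A' ∧ B = B' ∧ C = C' := by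
  refine ⟨fun h => ⟨congrFun h 0, congrFun h 1, congrFun h 2⟩, ?_⟩
  rintro ⟨rfl, rfl, rfl⟩
  rfl

theorem card_rowContent_comp4_one (a b c d : ℕ) (lam : ℕ → ℕ)
    (w : Equiv.Perm (Fin (a + b + c + d))) :
    (rowContent (comp4 a b c d) lam w 1).card = b := by
  have h : (Finset.univ.filter fun k : Fin (a + b + c + d) => rowOf (comp4 a b c d) k = 1).card
      = (Finset.Ico a (a + b)).card := by
    refine Finset.card_bij (fun k _ => (k : ℕ)) ?_ (fun _ _ _ _ h => Fin.ext h) ?_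
    · intro k hk
      have := (rowOf_eq_iff (isComposition_comp4 a b c d) k.2 1).1 (by simpa using hk)
      simpa [cumSum, comp4, Finset.sum_range_succ] using this
    · intro m hm
      rw [Finset.mem_Ico] at hm
      refine ⟨⟨m, by omega⟩, ?_, rfl⟩
      simp only [Finset.mem_filter, Finset.mem_univ, true_and]
      rw [rowOf_eq_iff (isComposition_comp4 a b c d) (by omega)]
      simpa [cumSum, comp4, Finset.sum_range_succ] using hm
  rw [rowContent, Multiset.card_map, Finset.card_val, h, Nat.card_Ico, Nat.add_sub_cancel_left]

theorem mem_youngW_of_is1A {a b c d : ℕ} {w : Equiv.Perm (Fin (a + b + c + d))}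
    (hw : Is1A (comp4 a b c d) (comp3 a (b + c) d)
      (rows4 (Multiset.replicate a 0) (Multiset.replicate b 1)
        (Multiset.replicate c 1) (Multiset.replicate d 2)) w) :
    w ∈ youngW (comp3 a (b + c) d) := by
  have hshape := rowsOfShape_rows4 (Multiset.replicate a 0) (Multiset.replicate b 1)
    (Multiset.replicate c 1) (Multiset.replicate d 2)
  simp only [Multiset.card_replicate] at hshape
  have h := rowContent_of_is1A (isComposition_comp4 a b c d) hshape hw
  obtain ⟨h0, h1, h2, h3⟩ := (rowContent_comp4_eq_rows4 _ _ _ _ _ _ _ _ _ _).1 h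
  intro p
  have hmem : ∀ i, rowOf (comp4 a b c d) (w p : Fin _) = i →
      rowOf (comp3 a (b + c) d) p ∈ rowContent (comp4 a b c d) (comp3 a (b + c) d) w i := by
    intro i hi
    exact Multiset.mem_map.2 ⟨w p, by simpa using hi, by simp⟩
  rcases rowOf_comp4_cases (w p).2 with h | h | h | h <;>
    have hm := hmem _ h.1 <;> rw [h.2] <;> symm
  · exact Multiset.eq_of_mem_replicate (h0 ▸ hm)
  · exact Multiset.eq_of_mem_replicate (h1 ▸ hm)
  · exact Multiset.eq_of_mem_replicate (h2 ▸ hm)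
  · exact Multiset.eq_of_mem_replicate (h3 ▸ hm)

theorem doubleCoset_eq_youngW {n : ℕ} {lam mu : ℕ → ℕ} {d : Equiv.Perm (Fin n)}
    (hsub : youngW (n := n) mu ⊆ youngW lam) (hd : d ∈ youngW lam) :
    doubleCoset lam mu d = youngW lam := by
  ext w
  constructor
  · rintro ⟨u, hu, v, hv, rfl⟩ p
    exact ((hsub hv _).trans (hd _)).trans (hu p)
  · intro hw
    refine ⟨d⁻¹ * w, fun p => ?_, 1, fun p => rfl, by group⟩
    have := hd (d⁻¹ (w p))
    rw [← Equiv.Perm.mul_apply, mul_inv_cancel, Equiv.Perm.one_apply] at this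
    exact this.symm.trans (hw p)

/-- Lemma: splitting a row in two.
`(r,u,v,t) ⊨ n`; `D` the `(r,u,v,t)`-tableau with rows of constant entries
`0,1,1,2` (paper: `1,2,2,3`), a tableau of type `(r,u+v,t)`; `E` a row-standard
`(r,u+v,t)`-tableau of type `λ` with rows `E0,E1,E2`; `𝒞` the set of row-standard
`(r,u,v,t)`-tableaux `C` with `C^1 = E^1`, `C^2 ⊔ C^3 = E^2`, `C^4 = E^3`, encoded by
the sub-multisets `U ≤ E1` with `|U| = u` (the rows of `C` being `E0, U, E1-U, E2`).
Then `φ_D φ_E = ∑_{C ∈ 𝒞} φ_C` as homomorphisms `M^{(r,u,v,t)} → M^λ`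
(apply `φ_D` first). -/
theorem split_row
    {F : Type*} [Field F] {H : Type*} [Ring H] [Algebra F H]
    {n r u v t : ℕ} (hn : r + u + v + t = n)
    (q : F) (hq : q ≠ 0)
    (T : Equiv.Perm (Fin n) → H) (hT : IsHeckeBasis q T)
    (E0 E1 E2 : Multiset ℕ)
    (hE0 : E0.card = r) (hE1 : E1.card = u + v) (hE2 : E2.card = t)
    (lam : ℕ → ℕ) (hlam : ∀ x, lam x = (E0 + E1 + E2).count x)
    (dD : Equiv.Perm (Fin n))
    (hdD : Is1A (comp4 r u v t) (comp3 r (u+v) t)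
      (rows4 (Multiset.replicate r 0) (Multiset.replicate u 1)
             (Multiset.replicate v 1) (Multiset.replicate t 2)) dD)
    (dE : Equiv.Perm (Fin n))
    (hdE : Is1A (comp3 r (u+v) t) lam (rows3 E0 E1 E2) dE)
    (dC : Multiset ℕ → Equiv.Perm (Fin n))
    (hdC : ∀ U ∈ E1.powerset.toFinset.filter (fun U => U.card = u),
      Is1A (comp4 r u v t) lam (rows4 E0 U (E1 - U) E2) (dC U))
    (M4 : Submodule Hᵐᵒᵖ H) (hM4 : M4 = Submodule.span Hᵐᵒᵖ {xElt T (comp4 r u v t)})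
    (M3 : Submodule Hᵐᵒᵖ H) (hM3 : M3 = Submodule.span Hᵐᵒᵖ {xElt T (comp3 r (u+v) t)})
    (hx4 : xElt T (comp4 r u v t) ∈ M4) (hx3 : xElt T (comp3 r (u+v) t) ∈ M3)
    (φD : M4 →ₗ[Hᵐᵒᵖ] H)
    (hφD : φD ⟨xElt T (comp4 r u v t), hx4⟩
      = XPhi T (comp3 r (u+v) t) (comp4 r u v t) dD)
    (hrange : ∀ z : M4, φD z ∈ M3)
    (φE : M3 →ₗ[Hᵐᵒᵖ] H)
    (hφE : φE ⟨xElt T (comp3 r (u+v) t), hx3⟩ = XPhi T lam (comp3 r (u+v) t) dE)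
    (φC : Multiset ℕ → (M4 →ₗ[Hᵐᵒᵖ] H))
    (hφC : ∀ U ∈ E1.powerset.toFinset.filter (fun U => U.card = u),
      φC U ⟨xElt T (comp4 r u v t), hx4⟩ = XPhi T lam (comp4 r u v t) (dC U)) :
    ∀ z : M4, φE ⟨φD z, hrange z⟩
      = ∑ U ∈ E1.powerset.toFinset.filter (fun U => U.card = u), φC U z := by
  subst hn
  have hD : φD ⟨_, hx4⟩ = xElt T (comp3 r (u + v) t) := by
    rw [hφD, XPhi, xElt,
      doubleCoset_eq_youngW (youngW_comp4_subset r u v t) (mem_youngW_of_is1A hdD)]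
  have hcomp3 : IsComposition (r + u + v + t) (comp3 r (u + v) t) := by
    simpa [add_assoc] using isComposition_comp3 r (u + v) t
  have hshapeE := rowsOfShape_rows3 E0 E1 E2
  rw [hE0, hE1, hE2] at hshapeE
  have hcE := rowContent_of_is1A hcomp3 hshapeE hdE
  have hcC : ∀ U ∈ E1.powerset.toFinset.filter (fun U => U.card = u),
      rowContent (comp4 r u v t) lam (dC U) = rows4 E0 U (E1 - U) E2 := by
    intro U hU
    have hU' : U ≤ E1 ∧ U.card = u := by simpa using hU
    have hshape := rowsOfShape_rows4 E0 U (E1 - U) E2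
    rw [Multiset.card_sub hU'.1, hE0, hE1, hE2, hU'.2, Nat.add_sub_cancel_left] at hshape
    exact rowContent_of_is1A (isComposition_comp4 r u v t) hshape (hdC U hU)
  have hgen : φE ⟨xElt T (comp3 r (u + v) t), hx3⟩ =
      ∑ U ∈ E1.powerset.toFinset.filter (fun U => U.card = u), φC U ⟨_, hx4⟩ := by
    rw [hφE, Finset.sum_congr rfl hφC, XPhi,
      ← Finset.sum_fiberwise_of_maps_to (g := fun w => rowContent (comp4 r u v t) lam w 1)
        (t := E1.powerset.toFinset.filter (fun U => U.card = u))]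
    · refine Finset.sum_congr rfl fun U hU => ?_
      have hU' : U ≤ E1 ∧ U.card = u := by simpa using hU
      rw [XPhi]
      refine Finset.sum_congr ?_ fun _ _ => rfl
      ext w
      simp only [Finset.mem_filter, Finset.mem_univ, true_and, mem_doubleCoset_iff]
      rw [hcE, hcC U hU, rowContent_comp3, rows3_inj, rowContent_comp4_eq_rows4]
      constructor
      · rintro ⟨⟨h0, h12, h3⟩, h1⟩
        refine ⟨h0, h1, ?_, h3⟩
        rw [← h12, h1, add_tsub_cancel_left]
      · rintro ⟨h0, h1, h2, h3⟩
        refine ⟨⟨h0, ?_, h3⟩, h1⟩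
        rw [h1, h2, add_tsub_cancel_of_le hU'.1]
    · intro w hw
      simp only [Finset.mem_filter, Finset.mem_univ, true_and, mem_doubleCoset_iff] at hw
      rw [hcE, rowContent_comp3, rows3_inj] at hw
      have hle : rowContent (comp4 r u v t) lam w 1 ≤ E1 := hw.2.1 ▸ Multiset.le_add_right _ _
      simpa using ⟨hle, card_rowContent_comp4_one r u v t lam w⟩
  rintro ⟨z, hz⟩
  obtain ⟨a, rfl⟩ := Submodule.mem_span_singleton.1 (hM4 ▸ hz)
  have hz' : (⟨a • xElt T (comp4 r u v t), hz⟩ : M4) = a • ⟨_, hx4⟩ := rfl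
  have hDz : (⟨φD ⟨a • xElt T (comp4 r u v t), hz⟩, hrange _⟩ : M3) = a • ⟨_, hx3⟩ := by
    ext
    change φD (a • ⟨_, hx4⟩) = a • xElt T (comp3 r (u + v) t)
    rw [map_smul, hD]
  rw [hDz, map_smul, hgen, Finset.smul_sum]
  exact Finset.sum_congr rfl fun U _ => by rw [hz', map_smul]

end FayersSemistd
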